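/- arXiv:1412.2601 — 5 statements merged into one kernel-verified Lean document; each statement's English description precedes it below -/
import Mathlib

section
/- Let φ : ℝ → ℝ satisfy φ(x) ≥ 0 for all x ≥ 0 and φ(x+y) ≥ φ(x) + φ(y) for all x, y ≥ 0 (φ is positive and superadditive on the nonnegative reals), and let η_ij ≥ 0 for i ∈ {1,…,k}, j ∈ {1,…,r}. Then the generalized clustering distance D_φ^η(U‖V) = Σ_j [ φ(Σ_i η_ij) − Σ_i φ(η_ij) ] satisfies 0 ≤ D_φ^η(U‖V) ≤ φ(Σ_j Σ_i η_ij). -/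
open Finset

/-- A function that is superadditive on the nonnegative reals and nonnegative at `0` is superadditive
over finite sums of nonnegative reals. -/
theorem sum_le_apply_sum_of_superadditive {ι : Type*} (s : Finset ι) (φ : ℝ → ℝ) (f : ι → ℝ)
    (hφ_zero : 0 ≤ φ 0)
    (hφ_superadd : ∀ x y : ℝ, 0 ≤ x → 0 ≤ y → φ x + φ y ≤ φ (x + y))
    (hf : ∀ i ∈ s, 0 ≤ f i) :
    ∑ i ∈ s, φ (f i) ≤ φ (∑ i ∈ s, f i) := by
  induction s using Finset.cons_induction with
  | empty => simpa using hφ_zero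
  | cons a s ha ih =>
    rw [Finset.forall_mem_cons] at hf
    rw [Finset.sum_cons, Finset.sum_cons]
    have h := hφ_superadd (f a) (∑ i ∈ s, f i) hf.1 (Finset.sum_nonneg hf.2)
    linarith [ih hf.2]

/-- If `φ : ℝ → ℝ` is nonnegative and superadditive on the
nonnegative reals, and `η` is a nonnegative `k × r` array, then the one-sided
generalized clustering distance
`D_φ^η(U‖V) = Σ_j [ φ(Σ_i η_ij) − Σ_i φ(η_ij) ]`
satisfies `0 ≤ D_φ^η(U‖V) ≤ φ(Σ_j Σ_i η_ij)`. -/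
theorem generalized_distance_bounds
    (k r : ℕ) (φ : ℝ → ℝ) (η : Fin k → Fin r → ℝ)
    (hφ_nonneg : ∀ x : ℝ, 0 ≤ x → 0 ≤ φ x)
    (hφ_superadd : ∀ x y : ℝ, 0 ≤ x → 0 ≤ y → φ x + φ y ≤ φ (x + y))
    (hη : ∀ i j, 0 ≤ η i j) :
    0 ≤ (∑ j, (φ (∑ i, η i j) - ∑ i, φ (η i j))) ∧
      (∑ j, (φ (∑ i, η i j) - ∑ i, φ (η i j))) ≤ φ (∑ j, ∑ i, η i j) := by
  have h0 : 0 ≤ φ 0 := hφ_nonneg 0 le_rfl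
  constructor
  · exact Finset.sum_nonneg fun j _ => sub_nonneg.2 <|
      sum_le_apply_sum_of_superadditive _ φ (fun i => η i j) h0 hφ_superadd fun i _ => hη i j
  · calc ∑ j, (φ (∑ i, η i j) - ∑ i, φ (η i j))
        ≤ ∑ j, φ (∑ i, η i j) := Finset.sum_le_sum fun j _ =>
          sub_le_self _ (Finset.sum_nonneg fun i _ => hφ_nonneg _ (hη i j))
      _ ≤ φ (∑ j, ∑ i, η i j) :=
          sum_le_apply_sum_of_superadditive _ φ (fun j => ∑ i, η i j) h0 hφ_superadd
            fun j _ => Finset.sum_nonneg fun i _ => hη i j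
end

section
/- Let (n_ij) be a k×r contingency table with all entries n_ij > 0, total n > 0, and H(U) + H(V) ≠ 0. Set φ(x) = x·log x and E = Σ_ij φ(n_i·•n_·j / n) = Σ_ij (n_i·•n_·j/n)·log(n_i·•n_·j/n). Then the adjusted generalized clustering distance with φ(x) = x·log x satisfies 1 − [ Σ_i φ(n_i·) + Σ_j φ(n_·j) − 2·Σ_ij φ(n_ij) ] / [ Σ_i φ(n_i·) + Σ_j φ(n_·j) − 2·E ] = 2·I(U,V) / (H(U) + H(V)), i.e. it equals one minus the sum-normalized Normalized Mutual Information NMI_Σ. -/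
open Finset

section

variable {ι κ : Type*} [Fintype ι] [Fintype κ]

theorem sum_div_mul_log_div {a : ι → ℝ} {n : ℝ} (ha : ∀ i, 0 < a i) (hn : 0 < n)
    (hsum : ∑ i, a i = n) :
    ∑ i, (a i / n) * Real.log (a i / n) = (∑ i, a i * Real.log (a i)) / n - Real.log n := by
  have h : ∀ i, (a i / n) * Real.log (a i / n)
      = a i * Real.log (a i) / n - a i * (Real.log n / n) := fun i => by
    rw [Real.log_div (ha i).ne' hn.ne']
    ring
  simp_rw [h, Finset.sum_sub_distrib, ← Finset.sum_div, ← Finset.sum_mul, hsum]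
  field_simp

theorem sum_mul_div_mul_log_mul_div {a : ι → ℝ} {b : κ → ℝ} {n : ℝ}
    (ha : ∀ i, 0 < a i) (hb : ∀ j, 0 < b j) (hn : 0 < n)
    (hasum : ∑ i, a i = n) (hbsum : ∑ j, b j = n) :
    ∑ i, ∑ j, (a i * b j / n) * Real.log (a i * b j / n)
      = ∑ i, a i * Real.log (a i) + ∑ j, b j * Real.log (b j) - n * Real.log n := by
  have h : ∀ i j, (a i * b j / n) * Real.log (a i * b j / n)
      = a i * Real.log (a i) / n * b j + a i / n * (b j * Real.log (b j))
        - a i * (Real.log n / n) * b j := fun i j => by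
    rw [Real.log_div (mul_pos (ha i) (hb j)).ne' hn.ne', Real.log_mul (ha i).ne' (hb j).ne']
    ring
  simp_rw [h, Finset.sum_sub_distrib, Finset.sum_add_distrib, ← Finset.mul_sum,
    ← Finset.sum_mul, ← Finset.sum_div, hasum, hbsum]
  field_simp

theorem sum_div_mul_log_mul_div {N : ι → κ → ℝ} {a : ι → ℝ} {b : κ → ℝ} {n : ℝ}
    (hN : ∀ i j, 0 < N i j) (ha : ∀ i, 0 < a i) (hb : ∀ j, 0 < b j) (hn : 0 < n)
    (hrow : ∀ i, ∑ j, N i j = a i) (hcol : ∀ j, ∑ i, N i j = b j) (hasum : ∑ i, a i = n) :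
    ∑ i, ∑ j, (N i j / n) * Real.log (N i j * n / (a i * b j))
      = (∑ i, ∑ j, N i j * Real.log (N i j) + n * Real.log n
        - ∑ i, a i * Real.log (a i) - ∑ j, b j * Real.log (b j)) / n := by
  have h : ∀ i j, (N i j / n) * Real.log (N i j * n / (a i * b j))
      = (N i j * Real.log (N i j) + N i j * Real.log n
        - N i j * Real.log (a i) - N i j * Real.log (b j)) / n := fun i j => by
    rw [Real.log_div (mul_pos (hN i j) hn).ne' (mul_pos (ha i) (hb j)).ne',
      Real.log_mul (hN i j).ne' hn.ne', Real.log_mul (ha i).ne' (hb j).ne']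
    ring
  have hcomm : ∑ i, ∑ j, N i j * Real.log (b j) = ∑ j, b j * Real.log (b j) := by
    rw [Finset.sum_comm]
    simp_rw [← Finset.sum_mul, hcol]
  simp_rw [h, ← Finset.sum_div, Finset.sum_sub_distrib, Finset.sum_add_distrib, hcomm,
    ← Finset.sum_mul, hrow, hasum]

end

/-- For a `k × r` contingency table with all entries positive,
total `n > 0`, and `H(U) + H(V) ≠ 0`, the adjusted generalized clustering
distance with `φ(x) = x·log x` satisfies
`1 − D/NF = 2·I(U,V)/(H(U)+H(V)) = NMI_Σ`. -/
theorem adjusted_distance_xlogx_eq_one_sub_nmi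
    (k r : ℕ) (N : Fin k → Fin r → ℝ)
    (hpos : ∀ i j, 0 < N i j)
    (n : ℝ) (hn : n = ∑ i, ∑ j, N i j) (hnpos : 0 < n)
    (hHne :
      (-(∑ i, ((∑ j, N i j) / n) * Real.log ((∑ j, N i j) / n)))
        + (-(∑ j, ((∑ i, N i j) / n) * Real.log ((∑ i, N i j) / n))) ≠ 0) :
    1 - ((∑ i, (∑ j, N i j) * Real.log (∑ j, N i j))
          + (∑ j, (∑ i, N i j) * Real.log (∑ i, N i j))
          - 2 * ∑ i, ∑ j, N i j * Real.log (N i j))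
        / ((∑ i, (∑ j, N i j) * Real.log (∑ j, N i j))
          + (∑ j, (∑ i, N i j) * Real.log (∑ i, N i j))
          - 2 * ∑ i, ∑ j,
              ((∑ j', N i j') * (∑ i', N i' j) / n) *
                Real.log ((∑ j', N i j') * (∑ i', N i' j) / n)) =
      2 * (∑ i, ∑ j, (N i j / n) *
            Real.log (N i j * n / ((∑ j', N i j') * (∑ i', N i' j))))
        / ((-(∑ i, ((∑ j, N i j) / n) * Real.log ((∑ j, N i j) / n)))
          + (-(∑ j, ((∑ i, N i j) / n) * Real.log ((∑ i, N i j) / n)))) := by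
  have hk : Nonempty (Fin k) := by
    by_contra hempty
    rw [not_nonempty_iff] at hempty
    simp [hn] at hnpos
  have hr : Nonempty (Fin r) := by
    by_contra hempty
    rw [not_nonempty_iff] at hempty
    simp [hn] at hnpos
  have ha : ∀ i, 0 < ∑ j, N i j := fun i =>
    Finset.sum_pos (fun j _ => hpos i j) Finset.univ_nonempty
  have hb : ∀ j, 0 < ∑ i, N i j := fun j =>
    Finset.sum_pos (fun i _ => hpos i j) Finset.univ_nonempty
  have hasum : ∑ i, ∑ j, N i j = n := hn.symm
  have hbsum : ∑ j, ∑ i, N i j = n := by rw [Finset.sum_comm, hasum]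
  have hU := sum_div_mul_log_div ha hnpos hasum
  have hV := sum_div_mul_log_div hb hnpos hbsum
  have hE := sum_mul_div_mul_log_mul_div ha hb hnpos hasum hbsum
  have hI := sum_div_mul_log_mul_div hpos ha hb hnpos (fun _ => rfl) (fun _ => rfl) hasum
  rw [hU, hV] at hHne
  rw [hU, hV, hE, hI]
  generalize ∑ i, (∑ j, N i j) * Real.log (∑ j, N i j) = A at *
  generalize ∑ j, (∑ i, N i j) * Real.log (∑ i, N i j) = B at *
  generalize ∑ i, ∑ j, N i j * Real.log (N i j) = C at *
  have hden : -(A / n - Real.log n) + -(B / n - Real.log n)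
      = (A + B - 2 * (A + B - n * Real.log n)) / n := by
    field_simp
    ring
  rw [hden] at hHne ⊢
  have hD : A + B - 2 * (A + B - n * Real.log n) ≠ 0 := fun h => hHne (by rw [h, zero_div])
  rw [one_sub_div hD, mul_div_assoc', div_div_div_cancel_right₀ hnpos.ne']
  ring
end

section
/- Let U be an n×k hard disjoint clustering matrix and V an n×r hard disjoint clustering matrix, with n ≥ 1. Then ‖U·Uᵀ − V·Vᵀ‖²_F / n² = 1 − RI', where RI' = 1 + (2·Σ_ij n_ij² − (Σ_i n_i·² + Σ_j n_·j²))/n² is the approximate Rand Index computed from the contingency table N = Uᵀ·V. Equivalently, ‖U·Uᵀ − V·Vᵀ‖²_F = Σ_i n_i·² + Σ_j n_·j² − 2·Σ_ij n_ij². -/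
open Finset Matrix

/-- The Frobenius inner product of two Gram matrices is the squared Frobenius norm of the
cross-product matrix. -/
theorem sum_mul_transpose_mul_eq_sum_sq {m κ ρ : Type*} [Fintype m] [Fintype κ] [Fintype ρ]
    (U : Matrix m κ ℝ) (V : Matrix m ρ ℝ) :
    ∑ a, ∑ b, (U * Uᵀ) a b * (V * Vᵀ) a b = ∑ i, ∑ j, ((Uᵀ * V) i j) ^ 2 := by
  have h₁ := Matrix.sum_hadamard_eq (U * Uᵀ) (V * Vᵀ)
  have h₂ := Matrix.sum_hadamard_eq (Uᵀ * V) (Uᵀ * V)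
  simp only [Matrix.hadamard_apply] at h₁ h₂
  simp only [pow_two]
  rw [h₁, h₂]
  simp only [Matrix.transpose_mul, Matrix.transpose_transpose]
  rw [Matrix.mul_assoc, Matrix.trace_mul_comm, Matrix.mul_assoc, Matrix.mul_assoc,
    Matrix.mul_assoc]

/-- Distinct columns of a hard disjoint clustering matrix have disjoint supports. -/
theorem mul_eq_zero_of_row_sum_eq_one {m κ : Type*} [Fintype κ] {U : Matrix m κ ℝ}
    (h01 : ∀ a i, U a i = 0 ∨ U a i = 1) (hrow : ∀ a, ∑ i, U a i = 1)
    (a : m) {i j : κ} (hij : i ≠ j) : U a i * U a j = 0 := by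
  classical
  have hnonneg : ∀ l, 0 ≤ U a l := fun l => by rcases h01 a l with h | h <;> simp [h]
  have hpair : ∑ l ∈ {i, j}, U a l ≤ ∑ l, U a l :=
    Finset.sum_le_sum_of_subset_of_nonneg (Finset.subset_univ _) fun l _ _ => hnonneg l
  rw [Finset.sum_pair hij, hrow a] at hpair
  rcases h01 a i with hi | hi <;> rcases h01 a j with hj | hj <;> simp [hi, hj]
  linarith

/-- The squared Frobenius norm of `Uᵀ * U`, for a hard disjoint clustering matrix `U`, is the
sum of the squared cluster sizes. -/
theorem sum_sq_transpose_mul_self {m κ : Type*} [Fintype m] [Fintype κ] {U : Matrix m κ ℝ}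
    (h01 : ∀ a i, U a i = 0 ∨ U a i = 1) (hrow : ∀ a, ∑ i, U a i = 1) :
    ∑ i, ∑ j, ((Uᵀ * U) i j) ^ 2 = ∑ i, (∑ a, U a i) ^ 2 := by
  refine Finset.sum_congr rfl fun i _ => ?_
  rw [Finset.sum_eq_single i]
  · congr 1
    rw [Matrix.mul_apply]
    refine Finset.sum_congr rfl fun a _ => ?_
    rcases h01 a i with h | h <;> simp [h]
  · intro j _ hji
    rw [Matrix.mul_apply, Finset.sum_eq_zero, zero_pow two_ne_zero]
    exact fun a _ => mul_eq_zero_of_row_sum_eq_one h01 hrow a hji.symm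
  · simp

/-- For hard disjoint clustering matrices `U : n × k` and
`V : n × r` with `n ≥ 1`, the squared Frobenius norm of the co-membership
difference divided by `n²` equals one minus the approximate Rand Index `RI'`
computed from the contingency table `N = Uᵀ·V`; equivalently,
`‖UUᵀ − VVᵀ‖²_F = Σ_i n_i·² + Σ_j n_·j² − 2·Σ_ij n_ij²`. -/
theorem coMembership_distance_eq_one_sub_riApprox
    (n k r : ℕ) (hn : 1 ≤ n)
    (U : Matrix (Fin n) (Fin k) ℝ) (V : Matrix (Fin n) (Fin r) ℝ)
    (hU01 : ∀ a i, U a i = 0 ∨ U a i = 1) (hUrow : ∀ a, ∑ i, U a i = 1)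
    (hV01 : ∀ a j, V a j = 0 ∨ V a j = 1) (hVrow : ∀ a, ∑ j, V a j = 1) :
    (∑ a, ∑ b, ((U * Uᵀ - V * Vᵀ) a b) ^ 2) / (n : ℝ) ^ 2 =
      1 - (1 + (2 * ∑ i, ∑ j, ((Uᵀ * V) i j) ^ 2
            - ((∑ i, (∑ a, U a i) ^ 2) + (∑ j, (∑ a, V a j) ^ 2))) / (n : ℝ) ^ 2) ∧
    (∑ a, ∑ b, ((U * Uᵀ - V * Vᵀ) a b) ^ 2) =
      (∑ i, (∑ a, U a i) ^ 2) + (∑ j, (∑ a, V a j) ^ 2)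
        - 2 * ∑ i, ∑ j, ((Uᵀ * V) i j) ^ 2 := by
  have key : (∑ a, ∑ b, ((U * Uᵀ - V * Vᵀ) a b) ^ 2) =
      (∑ i, (∑ a, U a i) ^ 2) + (∑ j, (∑ a, V a j) ^ 2)
        - 2 * ∑ i, ∑ j, ((Uᵀ * V) i j) ^ 2 := by
    rw [← sum_sq_transpose_mul_self hU01 hUrow, ← sum_sq_transpose_mul_self hV01 hVrow,
      ← sum_mul_transpose_mul_eq_sum_sq, ← sum_mul_transpose_mul_eq_sum_sq,
      ← sum_mul_transpose_mul_eq_sum_sq]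
    simp only [Finset.mul_sum, ← Finset.sum_add_distrib, ← Finset.sum_sub_distrib,
      Matrix.sub_apply]
    refine Finset.sum_congr rfl fun a _ => Finset.sum_congr rfl fun b _ => ?_
    ring
  refine ⟨?_, key⟩
  rw [key]
  ring
end

section
/- Let U be an n×k hard disjoint clustering matrix and V an n×r hard disjoint clustering matrix with n ≥ 1, and suppose NF := ‖U·Uᵀ‖²_F + ‖V·Vᵀ‖²_F − 2·|U·Uᵀ|·|V·Vᵀ|/n² is nonzero. Then ‖U·Uᵀ − V·Vᵀ‖²_F / NF = 1 − ARI', where ARI' = ( Σ_ij n_ij² − (Σ_i n_i·²)(Σ_j n_·j²)/n² ) / ( ½(Σ_i n_i·² + Σ_j n_·j²) − (Σ_i n_i·²)(Σ_j n_·j²)/n² ) is the approximate Adjusted Rand Index computed from the contingency table N = Uᵀ·V. -/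
open Finset Matrix

/-- The entries of the co-membership matrix of a hard clustering are `0` or `1`. -/
theorem mul_transpose_apply_sq_of_hard {α ι : Type*} [Fintype ι] {U : Matrix α ι ℝ}
    (h01 : ∀ a i, U a i = 0 ∨ U a i = 1) (hrow : ∀ a, ∑ i, U a i = 1) (a b : α) :
    ((U * Uᵀ) a b) ^ 2 = (U * Uᵀ) a b := by
  classical
  obtain ⟨c, hc⟩ : ∃ c, U a c = 1 := by
    by_contra! h
    have h0 : ∀ i, U a i = 0 := fun i => (h01 a i).resolve_right (h i)
    simpa [h0] using hrow a
  have hrest : ∀ i ≠ c, U a i = 0 := by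
    have hs : ∑ i ∈ univ.erase c, U a i = 0 := by
      have := add_sum_erase univ (U a) (mem_univ c)
      linarith [hrow a]
    have hnonneg : ∀ i ∈ univ.erase c, 0 ≤ U a i := fun i _ => by
      rcases h01 a i with h | h <;> simp [h]
    intro i hi
    exact (sum_eq_zero_iff_of_nonneg hnonneg).1 hs i (by simp [hi])
  have hval : (U * Uᵀ) a b = U b c := by
    rw [mul_apply, sum_eq_single c (fun i _ hi => by simp [hrest i hi]) (by simp)]
    simp [hc]
  rw [hval]
  rcases h01 b c with h | h <;> simp [h]

theorem sum_mul_transpose_apply {α ι : Type*} [Fintype α] [Fintype ι] (U : Matrix α ι ℝ) :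
    ∑ a, ∑ b, (U * Uᵀ) a b = ∑ i, (∑ a, U a i) ^ 2 := by
  simp_rw [mul_apply, transpose_apply, sq, sum_mul_sum]
  rw [sum_comm (s := (univ : Finset ι))]
  exact sum_congr rfl fun _ _ => sum_comm

theorem sum_mul_apply_eq_trace {β γ : Type*} [Fintype β] [Fintype γ] (A B : Matrix β γ ℝ) :
    ∑ a, ∑ b, A a b * B a b = (A * Bᵀ).trace := by
  simp [trace, mul_apply]

/-- The Frobenius inner product of `U * Uᵀ` and `V * Vᵀ` is the squared Frobenius norm of
`Uᵀ * V`. -/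
theorem sum_mul_transpose_mul_mul_transpose {α ι κ : Type*} [Fintype α] [Fintype ι] [Fintype κ]
    (U : Matrix α ι ℝ) (V : Matrix α κ ℝ) :
    ∑ a, ∑ b, (U * Uᵀ) a b * (V * Vᵀ) a b = ∑ i, ∑ j, ((Uᵀ * V) i j) ^ 2 := by
  calc
    _ = (U * Uᵀ * (V * Vᵀ)ᵀ).trace := sum_mul_apply_eq_trace _ _
    _ = (Uᵀ * V * (Uᵀ * V)ᵀ).trace := by
      simp only [transpose_mul, transpose_transpose]
      rw [Matrix.mul_assoc, trace_mul_comm]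
      simp only [Matrix.mul_assoc]
    _ = _ := by
      simp_rw [sq]
      exact (sum_mul_apply_eq_trace _ _).symm

/-- For hard disjoint clustering matrices `U : n × k` and
`V : n × r` with `n ≥ 1` and nonzero normalizing factor
`NF = ‖UUᵀ‖²_F + ‖VVᵀ‖²_F − 2·|UUᵀ|·|VVᵀ|/n²`, we have
`‖UUᵀ − VVᵀ‖²_F / NF = 1 − ARI'`, where `ARI'` is the approximate Adjusted
Rand Index computed from the contingency table `N = Uᵀ·V`. -/
theorem coMembership_distance_eq_one_sub_ariApprox
    (n k r : ℕ) (hn : 1 ≤ n)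
    (U : Matrix (Fin n) (Fin k) ℝ) (V : Matrix (Fin n) (Fin r) ℝ)
    (hU01 : ∀ a i, U a i = 0 ∨ U a i = 1) (hUrow : ∀ a, ∑ i, U a i = 1)
    (hV01 : ∀ a j, V a j = 0 ∨ V a j = 1) (hVrow : ∀ a, ∑ j, V a j = 1)
    (hNF : (∑ a, ∑ b, ((U * Uᵀ) a b) ^ 2) + (∑ a, ∑ b, ((V * Vᵀ) a b) ^ 2)
        - 2 * (∑ a, ∑ b, (U * Uᵀ) a b) * (∑ a, ∑ b, (V * Vᵀ) a b) / (n : ℝ) ^ 2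
          ≠ 0) :
    (∑ a, ∑ b, ((U * Uᵀ - V * Vᵀ) a b) ^ 2)
      / ((∑ a, ∑ b, ((U * Uᵀ) a b) ^ 2) + (∑ a, ∑ b, ((V * Vᵀ) a b) ^ 2)
        - 2 * (∑ a, ∑ b, (U * Uᵀ) a b) * (∑ a, ∑ b, (V * Vᵀ) a b) / (n : ℝ) ^ 2) =
    1 - ((∑ i, ∑ j, ((Uᵀ * V) i j) ^ 2)
          - (∑ i, (∑ a, U a i) ^ 2) * (∑ j, (∑ a, V a j) ^ 2) / (n : ℝ) ^ 2)
        / ((1 / 2) * ((∑ i, (∑ a, U a i) ^ 2) + (∑ j, (∑ a, V a j) ^ 2))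
          - (∑ i, (∑ a, U a i) ^ 2) * (∑ j, (∑ a, V a j) ^ 2) / (n : ℝ) ^ 2) := by
  have hsub : ∑ a, ∑ b, ((U * Uᵀ - V * Vᵀ) a b) ^ 2 =
      (∑ a, ∑ b, ((U * Uᵀ) a b) ^ 2) + (∑ a, ∑ b, ((V * Vᵀ) a b) ^ 2)
        - 2 * ∑ a, ∑ b, (U * Uᵀ) a b * (V * Vᵀ) a b := by
    simp only [mul_sum, ← sum_add_distrib, ← sum_sub_distrib]
    refine sum_congr rfl fun a _ => sum_congr rfl fun b _ => ?_
    rw [Matrix.sub_apply]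
    ring
  rw [hsub]
  simp only [mul_transpose_apply_sq_of_hard hU01 hUrow, mul_transpose_apply_sq_of_hard hV01 hVrow,
    sum_mul_transpose_apply, sum_mul_transpose_mul_mul_transpose] at hNF ⊢
  set S := ∑ i, (∑ a, U a i) ^ 2
  set T := ∑ j, (∑ a, V a j) ^ 2
  set P := ∑ i, ∑ j, ((Uᵀ * V) i j) ^ 2
  have hhalf : 1 / 2 * (S + T) - S * T / (n : ℝ) ^ 2 =
      (S + T - 2 * S * T / (n : ℝ) ^ 2) / 2 := by ring
  rw [hhalf, eq_sub_iff_add_eq, div_div_eq_mul_div, ← add_div, div_eq_one_iff_eq hNF]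
  ring
end

section
/- Let U be an n×k hard disjoint clustering matrix and V an n×r hard disjoint clustering matrix, with n ≥ 2. Then ‖U·Uᵀ − V·Vᵀ‖²_F / (n(n−1)) = 1 − RI, where RI = 1 + (2·Σ_ij n_ij² − (Σ_i n_i·² + Σ_j n_·j²))/(n² − n) is the exact Rand Index computed from the contingency table N = Uᵀ·V. -/
open Finset Matrix

section CoMembership

variable {m k r R : Type*} [Fintype k] [Fintype r]

/-- The entrywise inner product of two Gram matrices is the sum of squares of the
cross product matrix. -/
theorem sum_gram_mul_gram [Fintype m] [CommRing R] (U : Matrix m k R) (V : Matrix m r R) :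
    ∑ a, ∑ b, (U * Uᵀ) a b * (V * Vᵀ) a b = ∑ i, ∑ j, ((Uᵀ * V) i j) ^ 2 := by
  have h₁ : ∑ a, ∑ b, (U * Uᵀ) a b * (V * Vᵀ) a b = trace ((U * Uᵀ) * (V * Vᵀ)ᵀ) := by
    simp only [trace, diag_apply, mul_apply (M := U * Uᵀ), transpose_apply]
  have h₂ : ∑ i, ∑ j, ((Uᵀ * V) i j) ^ 2 = trace ((Uᵀ * V) * (Uᵀ * V)ᵀ) := by
    simp only [trace, diag_apply, mul_apply (M := Uᵀ * V), transpose_apply, sq]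
  rw [h₁, h₂, transpose_mul, transpose_mul, transpose_transpose, transpose_transpose,
    Matrix.mul_assoc, trace_mul_comm]
  simp only [Matrix.mul_assoc]

/-- The entries of a Gram matrix add up to the sum of the squared column sums. -/
theorem sum_gram [Fintype m] [CommRing R] (U : Matrix m k R) :
    ∑ a, ∑ b, (U * Uᵀ) a b = ∑ i, (∑ a, U a i) ^ 2 := by
  simpa [mul_apply] using sum_gram_mul_gram U (Matrix.of fun _ (_ : Unit) => (1 : R))

/-- The co-membership matrix of a hard disjoint clustering has idempotent entries. -/
theorem sq_gram_apply_of_hard {U : Matrix m k ℝ}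
    (h01 : ∀ a i, U a i = 0 ∨ U a i = 1) (hrow : ∀ a, ∑ i, U a i = 1) (a b : m) :
    ((U * Uᵀ) a b) ^ 2 = (U * Uᵀ) a b := by
  classical
  have hnonneg : ∀ j, 0 ≤ U a j := fun j => by rcases h01 a j with h | h <;> simp [h]
  obtain ⟨i, hi⟩ : ∃ i, U a i = 1 := by
    by_contra! h
    have := hrow a
    simp [fun i => (h01 a i).resolve_right (h i)] at this
  have hother : ∀ j, j ≠ i → U a j = 0 := fun j hj => by
    have := Finset.sum_le_sum_of_subset_of_nonneg (Finset.subset_univ {i, j})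
      fun x _ _ => hnonneg x
    rw [hrow, Finset.sum_pair hj.symm, hi] at this
    linarith [hnonneg j]
  have hgram : (U * Uᵀ) a b = U b i := by
    rw [mul_apply, Finset.sum_eq_single i (fun j _ hj => by simp [hother j hj]) (by simp)]
    simp [hi]
  rcases h01 b i with h | h <;> simp [hgram, h]

end CoMembership

/-- For hard disjoint clustering matrices `U : n × k` and
`V : n × r` with `n ≥ 2`, `‖UUᵀ − VVᵀ‖²_F / (n(n−1)) = 1 − RI`, where `RI`
is the exact Rand Index computed from the contingency table `N = Uᵀ·V`. -/
theorem coMembership_distance_eq_one_sub_randIndex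
    (n k r : ℕ) (hn : 2 ≤ n)
    (U : Matrix (Fin n) (Fin k) ℝ) (V : Matrix (Fin n) (Fin r) ℝ)
    (hU01 : ∀ a i, U a i = 0 ∨ U a i = 1) (hUrow : ∀ a, ∑ i, U a i = 1)
    (hV01 : ∀ a j, V a j = 0 ∨ V a j = 1) (hVrow : ∀ a, ∑ j, V a j = 1) :
    (∑ a, ∑ b, ((U * Uᵀ - V * Vᵀ) a b) ^ 2) / ((n : ℝ) * ((n : ℝ) - 1)) =
      1 - (1 + (2 * ∑ i, ∑ j, ((Uᵀ * V) i j) ^ 2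
            - ((∑ i, (∑ a, U a i) ^ 2) + (∑ j, (∑ a, V a j) ^ 2)))
          / ((n : ℝ) ^ 2 - (n : ℝ))) := by
  have hfrob : ∑ a, ∑ b, ((U * Uᵀ - V * Vᵀ) a b) ^ 2 =
      (∑ i, (∑ a, U a i) ^ 2) + (∑ j, (∑ a, V a j) ^ 2)
        - 2 * ∑ i, ∑ j, ((Uᵀ * V) i j) ^ 2 := by
    rw [← sum_gram U, ← sum_gram V, ← sum_gram_mul_gram U V]
    simp only [Finset.mul_sum, ← Finset.sum_add_distrib, ← Finset.sum_sub_distrib]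
    refine Finset.sum_congr rfl fun a _ => Finset.sum_congr rfl fun b _ => ?_
    rw [Matrix.sub_apply]
    linear_combination sq_gram_apply_of_hard hU01 hUrow a b + sq_gram_apply_of_hard hV01 hVrow a b
  rw [hfrob, show (n : ℝ) * ((n : ℝ) - 1) = (n : ℝ) ^ 2 - n by ring]
  ring
end
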